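/- arXiv:2404.19718 — 7 statements merged into one kernel-verified Lean document; each statement's English description precedes it below -/
import Mathlib

section
/- Consider the graph on the circle ℝ/ℤ in which v and w are adjacent iff w = v + 1/4 or w = v − 1/4. The function f : ℝ/ℤ → {0,1,2} given by f(v) = 2 for v ∈ [0, 1/4), f(v) = 1 for v ∈ [1/2, 3/4), and f(v) = 0 otherwise is a measurable Roman dominating function for this graph of measured value 3/4. -/
open MeasureTheory Classical

lemma qc_mem {a b x : ℝ} (ha : 0 ≤ a) (hb : b ≤ 1) (hx : x ∈ Set.Ico (0:ℝ) 1) :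
    (x : AddCircle (1:ℝ)) ∈ (fun x : ℝ => (x : AddCircle (1:ℝ))) '' Set.Ico a b ↔
      x ∈ Set.Ico a b := by
  constructor
  · rintro ⟨y, hy, hxy⟩
    have hx' : x ∈ Set.Ico (0:ℝ) (0+1) := by simpa using hx
    have hy' : y ∈ Set.Ico (0:ℝ) (0+1) :=
      ⟨ha.trans hy.1, by linarith [hy.2]⟩
    have h := (AddCircle.coe_eq_coe_iff_of_mem_Ico hy' hx').1 hxy
    exact h ▸ hy
  · intro h
    exact ⟨x, h, rfl⟩

lemma qc_rep (v : AddCircle (1:ℝ)) : ∃ x ∈ Set.Ico (0:ℝ) 1, (x : AddCircle (1:ℝ)) = v := by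
  have h : v ∈ ((↑) : ℝ → AddCircle (1:ℝ)) '' Set.Ico 0 (0 + 1) := by
    rw [AddCircle.coe_image_Ico_eq]; trivial
  simpa using h

lemma qc_meas {a b : ℝ} (ha : 0 ≤ a) (hb : b ≤ 1) :
    MeasurableSet ((fun x : ℝ => (x : AddCircle (1:ℝ))) '' Set.Ico a b) := by
  have : (fun x : ℝ => (x : AddCircle (1:ℝ))) '' Set.Ico a b =
      (fun v => ((AddCircle.measurableEquivIco (1:ℝ) 0 v : Set.Ico (0:ℝ) (0+1)) : ℝ)) ⁻¹'
        Set.Ico a b := by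
    ext v
    have h2 : v = ((AddCircle.measurableEquivIco (1:ℝ) 0 v : ℝ) : AddCircle (1:ℝ)) :=
      ((AddCircle.measurableEquivIco (1:ℝ) 0).symm_apply_apply v).symm
    have h3 := (AddCircle.measurableEquivIco (1:ℝ) 0 v).2
    have := qc_mem ha hb ⟨h3.1, h3.2.trans_le (zero_add (1:ℝ)).le⟩
    rw [← h2] at this
    exact this
  rw [this]
  exact (measurable_subtype_coe.comp (AddCircle.measurableEquivIco (1:ℝ) 0).measurable)
    measurableSet_Ico

lemma qc_vol {a b : ℝ} (ha : 0 ≤ a) (hb : b ≤ 1) :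
    volume ((fun x : ℝ => (x : AddCircle (1:ℝ))) '' Set.Ico a b) = ENNReal.ofReal (b - a) := by
  rw [AddCircle.add_projection_respects_measure (1:ℝ) 0 (qc_meas ha hb), ← Real.volume_Ico,
    zero_add]
  have h : ((QuotientAddGroup.mk ⁻¹' ((fun x : ℝ => (x : AddCircle (1:ℝ))) '' Set.Ico a b) ∩
      Set.Ioc (0:ℝ) 1 : Set ℝ)) =ᵐ[volume]
      ((QuotientAddGroup.mk ⁻¹' ((fun x : ℝ => (x : AddCircle (1:ℝ))) '' Set.Ico a b) ∩
      Set.Ico (0:ℝ) 1 : Set ℝ)) :=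
    (Filter.EventuallyEq.refl _ _).inter Ico_ae_eq_Ioc.symm
  rw [measure_congr h]
  congr 1
  ext x
  constructor
  · rintro ⟨h1, h2⟩
    exact (qc_mem ha hb h2).1 h1
  · intro h1
    exact ⟨⟨x, h1, rfl⟩, ha.trans h1.1, h1.2.trans_le hb⟩

/-- On the circle ℝ/ℤ with adjacency `w = v ± 1/4`, the function labelling
`[0,1/4)` with 2, `[1/2,3/4)` with 1 and everything else with 0 is a measurable
Roman dominating function of measured value 3/4. -/
theorem quarter_circle_roman_dominating_function
    (f : AddCircle (1:ℝ) → ℕ)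
    (hf : f = fun v =>
      if v ∈ (fun x : ℝ => (x : AddCircle (1:ℝ))) '' Set.Ico (0:ℝ) (1/4) then 2
      else if v ∈ (fun x : ℝ => (x : AddCircle (1:ℝ))) '' Set.Ico (1/2:ℝ) (3/4) then 1
      else 0) :
    (∀ v, f v ≤ 2) ∧
    (∀ v, f v = 0 →
      f (v + ((1/4 : ℝ) : AddCircle (1:ℝ))) = 2 ∨
      f (v - ((1/4 : ℝ) : AddCircle (1:ℝ))) = 2) ∧
    MeasurableSet (f ⁻¹' {1}) ∧ MeasurableSet (f ⁻¹' {2}) ∧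
    2 * volume (f ⁻¹' {2}) + volume (f ⁻¹' {1}) = 3/4 := by
  have e2 : f ⁻¹' {2} = (fun x : ℝ => (x : AddCircle (1:ℝ))) '' Set.Ico (0:ℝ) (1/4) := by
    ext v
    simp only [hf, Set.mem_preimage, Set.mem_singleton_iff]
    split_ifs <;> simp_all
  have e1 : f ⁻¹' {1} = (fun x : ℝ => (x : AddCircle (1:ℝ))) '' Set.Ico (1/2:ℝ) (3/4) := by
    ext v
    obtain ⟨x, hx, rfl⟩ := qc_rep v
    simp only [hf, Set.mem_preimage, Set.mem_singleton_iff]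
    rw [qc_mem (by norm_num) (by norm_num) hx, qc_mem (by norm_num) (by norm_num) hx]
    simp only [Set.mem_Ico]
    split_ifs with h1 h2
    · constructor
      · intro h; omega
      · intro h; linarith [h.1, h1.2]
    · simp only [true_iff]; exact h2
    · simp only [zero_ne_one, false_iff]; exact h2
  refine ⟨?_, ?_, ?_, ?_, ?_⟩
  · intro v
    simp only [hf]
    split_ifs <;> omega
  · intro v hv
    have key : ∀ w, w ∈ (fun x : ℝ => (x : AddCircle (1:ℝ))) '' Set.Ico (0:ℝ) (1/4) → f w = 2 := by
      intro w hw
      rw [← e2] at hw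
      exact hw
    obtain ⟨x, hx, rfl⟩ := qc_rep v
    simp only [hf] at hv
    rw [qc_mem (by norm_num) (by norm_num) hx, qc_mem (by norm_num) (by norm_num) hx] at hv
    simp only [Set.mem_Ico] at hv hx
    split_ifs at hv with h1 h2
    have h3 : 1/4 ≤ x := by
      by_contra h
      exact h1 ⟨hx.1, not_le.1 h⟩
    by_cases h4 : x < 1/2
    · right
      exact key _ ⟨x - 1/4, ⟨by linarith, by linarith⟩, AddCircle.coe_sub ..⟩
    · left
      have h5 : 3/4 ≤ x := by
        by_contra h
        exact h2 ⟨not_lt.1 h4, not_le.1 h⟩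
      refine key _ ⟨x + 1/4 - 1, ⟨by linarith, by linarith [hx.2]⟩, ?_⟩
      simp only [AddCircle.coe_sub, AddCircle.coe_add, AddCircle.coe_period, sub_zero]
  · rw [e1]; exact qc_meas (by norm_num) (by norm_num)
  · rw [e2]; exact qc_meas (by norm_num) (by norm_num)
  · rw [e1, e2, qc_vol (by norm_num) (by norm_num), qc_vol (by norm_num) (by norm_num)]
    have h2 : (2 : ENNReal) = ENNReal.ofReal 2 := by simp
    have h3 : (3/4 : ENNReal) = ENNReal.ofReal (3/4) := by
      rw [ENNReal.ofReal_div_of_pos (by norm_num)]; simp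
    rw [h2, h3, ← ENNReal.ofReal_mul (by norm_num), ← ENNReal.ofReal_add (by norm_num) (by norm_num)]
    norm_num
end

section
/- Consider the graph on the circle ℝ/ℤ in which v and w are adjacent iff w = v + 1/4 or w = v − 1/4. Every measurable Roman dominating function f for this graph with f⁻¹{1} = ∅ has measured value at least 1, i.e. 2·μ(f⁻¹{2}) ≥ 1. -/
open MeasureTheory

/-- On the circle ℝ/ℤ with adjacency `w = v ± 1/4`, every measurable Roman
dominating function using no label 1 has measured value at least 1. -/
theorem quarter_circle_no_ones_measured_value_ge_one
    (f : AddCircle (1:ℝ) → ℕ) (hf2 : ∀ v, f v ≤ 2)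
    (hrdf : ∀ v, f v = 0 →
      f (v + ((1/4 : ℝ) : AddCircle (1:ℝ))) = 2 ∨
      f (v - ((1/4 : ℝ) : AddCircle (1:ℝ))) = 2)
    (h1 : MeasurableSet (f ⁻¹' {1})) (h2 : MeasurableSet (f ⁻¹' {2}))
    (hno1 : f ⁻¹' {1} = ∅) :
    1 ≤ 2 * volume (f ⁻¹' {2}) := by
  set q : AddCircle (1:ℝ) := ((1/4 : ℝ) : AddCircle (1:ℝ)) with hq
  have h4 : q + q + q + q = 0 := by
    rw [hq, ← AddCircle.coe_add, ← AddCircle.coe_add, ← AddCircle.coe_add]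
    norm_num
  have hval : ∀ v, f v = 2 ∨ f v = 0 := by
    intro v
    have h := hf2 v
    have hn : f v ≠ 1 := by
      intro hv
      have : v ∈ f ⁻¹' {1} := hv
      rw [hno1] at this
      exact this
    omega
  have hdom : ∀ v, f v = 2 ∨ f (v + q) = 2 ∨ f (v + (q + q + q)) = 2 := by
    intro v
    have e : v - q = v + (q + q + q) := by
      rw [sub_eq_iff_eq_add, add_assoc, h4, add_zero]
    rcases hval v with h | h
    · exact Or.inl h
    · rw [← e]
      exact Or.inr (hrdf v h)
  set g : AddCircle (1:ℝ) → ENNReal := (f ⁻¹' {2}).indicator 1 with hg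
  have hgm : Measurable g := measurable_one.indicator h2
  have hg1 : ∀ v, f v = 2 → g v = 1 := fun v hv => by
    rw [hg, Set.indicator_of_mem (show v ∈ f ⁻¹' {2} from hv)]; rfl
  have hg0 : ∀ v, f v = 0 → g v = 0 := fun v hv => by
    rw [hg, Set.indicator_of_notMem]
    simp [hv]
  have hle : ∀ v, (2 : ENNReal) ≤ g v + g (v + q) + g (v + (q + q)) + g (v + (q + q + q)) := by
    intro v
    have d0 := hdom v
    have d1 := hdom (v + q)
    have d2 := hdom (v + (q + q))
    have d3 := hdom (v + (q + q + q))
    rw [show v + q + q = v + (q + q) by abel,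
      show v + q + (q + q + q) = v + (q + q + q + q) by abel, h4, add_zero] at d1
    rw [show v + (q + q) + q = v + (q + q + q) by abel,
      show v + (q + q) + (q + q + q) = v + q + (q + q + q + q) by abel, h4, add_zero] at d2
    rw [show v + (q + q + q) + q = v + (q + q + q + q) by abel,
      show v + (q + q + q) + (q + q + q) = v + (q + q) + (q + q + q + q) by abel,
      h4, add_zero, add_zero] at d3
    rcases hval v with a | a <;> rcases hval (v + q) with b | b <;>
      rcases hval (v + (q + q)) with c | c <;> rcases hval (v + (q + q + q)) with d | d <;>
      first
      | (exfalso; omega)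
      | (simp only [a, b, c, d, hg0, hg1]; norm_num)
  have hint : ∫⁻ v, g v = volume (f ⁻¹' {2}) := lintegral_indicator_one h2
  have hsh : ∀ a, ∫⁻ v, g (v + a) = volume (f ⁻¹' {2}) := fun a => by
    rw [lintegral_add_right_eq_self g a, hint]
  have hm : ∀ a, Measurable fun v => g (v + a) := fun a => hgm.comp (measurable_add_const a)
  have key := lintegral_mono (μ := (volume : Measure (AddCircle (1:ℝ)))) hle
  rw [lintegral_add_right _ (hm _), lintegral_add_right _ (hm _), lintegral_add_right _ (hm _),
    hsh, hsh, hsh, hint, lintegral_const, AddCircle.measure_univ, ENNReal.ofReal_one, mul_one] at key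
  have k2 : 2 * (1 : ENNReal) ≤ 2 * (2 * volume (f ⁻¹' {2})) := by
    calc 2 * (1 : ENNReal) = 2 := mul_one _
      _ ≤ _ := key
      _ = _ := by ring
  exact (ENNReal.mul_le_mul_iff_right (by norm_num) (by norm_num)).1 k2
end

section
/- Fix an irrational α with 0 < α < 1. For every ε > 0 there exists a measurable Roman dominating function f for the irrational cycle graph G_α with f⁻¹{1} = ∅ and measured value 2·μ(f⁻¹{2}) < 2/3 + ε. In particular, the infimum of the measured values of measurable Roman dominating functions for G_α is at most 2/3. -/
open MeasureTheory
open scoped ENNReal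


lemma exists_height (α : ℝ) (hirr : Irrational α) (A : Set (AddCircle (1:ℝ))) (hA : IsOpen A)
    (hne : A.Nonempty) (v : AddCircle (1:ℝ)) : ∃ k : ℕ, v - k • (α : AddCircle (1:ℝ)) ∈ A := by
  have h : DenseRange (· • (α : AddCircle (1:ℝ)) : ℤ → AddCircle (1:ℝ)) :=
    AddCircle.denseRange_zsmul_coe_iff.2 (by simpa using hirr)
  have h2 : DenseRange (· • (α : AddCircle (1:ℝ)) : ℕ → AddCircle (1:ℝ)) :=
    denseRange_zsmul_iff_nsmul.1 h
  obtain ⟨a, ha⟩ := hne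
  have hopen : IsOpen ((fun x => v - x) ⁻¹' A) := hA.preimage (by fun_prop)
  obtain ⟨k, hk⟩ := h2.exists_mem_open hopen ⟨v - a, by simpa using ha⟩
  exact ⟨k, hk⟩

lemma exists_dominating (α : ℝ) (hirr : Irrational α) (A : Set (AddCircle (1:ℝ))) (hA : IsOpen A)
    (hne : A.Nonempty) : ∃ D : Set (AddCircle (1:ℝ)), MeasurableSet D ∧
      (∀ v, v ∉ D → v + (α : AddCircle (1:ℝ)) ∈ D ∨ v - (α : AddCircle (1:ℝ)) ∈ D) ∧
      3 * volume.real D ≤ 1 + 4 * volume.real A := by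
  classical
  set β : AddCircle (1:ℝ) := (α : AddCircle (1:ℝ)) with hβ
  have hp := exists_height α hirr A hA hne
  let r : AddCircle (1:ℝ) → ℕ := fun v => Nat.find (hp v)
  have hr : Measurable r := by
    refine measurable_find hp fun k => ?_
    have : IsOpen ((fun v : AddCircle (1:ℝ) => v - k • β) ⁻¹' A) := hA.preimage (by fun_prop)
    exact this.measurableSet
  have hr0 : ∀ v, r v = 0 ↔ v ∈ A := by
    intro v
    simp [r, Nat.find_eq_zero]
  have hsucc : ∀ v, v ∉ A → r v = r (v - β) + 1 := by
    intro v hv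
    have e : ∀ k : ℕ, v - β - k • β = v - (k + 1) • β := by
      intro k; rw [succ_nsmul']; abel
    have h1 := Nat.find_spec (hp (v - β))
    have h2 := Nat.find_spec (hp v)
    have hpos : r v ≠ 0 := fun h => hv ((hr0 v).1 h)
    obtain ⟨m, hm⟩ := Nat.exists_eq_succ_of_ne_zero hpos
    apply le_antisymm
    · apply Nat.find_min'
      rw [← e]; exact h1
    · rw [hm]
      apply Nat.succ_le_succ
      apply Nat.find_min'
      rw [e]
      change v - (r v) • β ∈ A at h2
      rwa [hm] at h2
  let L : ℕ → Set (AddCircle (1:ℝ)) := fun i => (fun v => r v % 3) ⁻¹' {i}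
  have hL : ∀ i, MeasurableSet (L i) := fun i =>
    ((measurable_from_nat (f := fun n => n % 3)).comp hr) (measurableSet_singleton i)
  have hmem : ∀ i v, v ∈ L i ↔ r v % 3 = i := fun i v => Iff.rfl
  have tr : ∀ (S : Set (AddCircle (1:ℝ))) (c : AddCircle (1:ℝ)),
      volume.real ((fun v => v + c) ⁻¹' S) = volume.real S := by
    intro S c
    simp only [Measure.real, measure_preimage_add_right]
  have htot : volume.real (L 0) + volume.real (L 1) + volume.real (L 2) = 1 := by
    have hu : (L 0 ∪ L 1) ∪ L 2 = Set.univ := by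
      ext v
      simp only [Set.mem_union, hmem, Set.mem_univ, iff_true]
      omega
    have d1 : Disjoint (L 0) (L 1) := by
      rw [Set.disjoint_left]; intro v; simp only [hmem]; omega
    have d2 : Disjoint (L 0 ∪ L 1) (L 2) := by
      rw [Set.disjoint_left]; intro v; simp only [Set.mem_union, hmem]; omega
    rw [← measureReal_union d1 (hL 1), ← measureReal_union d2 (hL 2), hu]
    simp [Measure.real, AddCircle.measure_univ]
  have h10 : volume.real (L 1) ≤ volume.real (L 0) := by
    rw [← tr (L 0) (-β)]
    refine measureReal_mono ?_
    intro v hv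
    rw [hmem] at hv
    have hvA : v ∉ A := fun h => by have := (hr0 v).2 h; omega
    have := hsucc v hvA
    rw [Set.mem_preimage, hmem, ← sub_eq_add_neg]
    omega
  have h12 : volume.real (L 1) ≤ volume.real (L 2) + volume.real A := by
    rw [← tr (L 2) (-β + -β), ← tr A (-β)]
    refine (measureReal_mono ?_).trans (measureReal_union_le _ _)
    intro v hv
    rw [hmem] at hv
    have hvA : v ∉ A := fun h => by have := (hr0 v).2 h; omega
    have h1 := hsucc v hvA
    by_cases h : v - β ∈ A
    · right
      rwa [Set.mem_preimage, ← sub_eq_add_neg]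
    · left
      have h2 := hsucc _ h
      rw [Set.mem_preimage, hmem, ← add_assoc, ← sub_eq_add_neg, ← sub_eq_add_neg]
      omega
  refine ⟨L 1 ∪ (fun v => v + β) ⁻¹' A, ?_, ?_, ?_⟩
  · exact (hL 1).union (hA.preimage (by fun_prop)).measurableSet
  · intro v hv
    simp only [Set.mem_union, Set.mem_preimage, not_or, hmem] at hv ⊢
    obtain ⟨hv1, hv2⟩ := hv
    have h1 := hsucc _ hv2
    rw [add_sub_cancel_right] at h1
    by_cases h : r v % 3 = 0
    · left; left; omega
    · right; left
      have hvA : v ∉ A := fun h => by have := (hr0 v).2 h; omega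
      have := hsucc v hvA
      omega
  · have := measureReal_union_le (μ := volume) (L 1) ((fun v => v + β) ⁻¹' A)
    rw [tr] at this
    linarith

lemma exists_dominating_small (α : ℝ) (hirr : Irrational α) (ε : ℝ≥0∞) (hε : 0 < ε) :
    ∃ D : Set (AddCircle (1:ℝ)), MeasurableSet D ∧
      (∀ v, v ∉ D → v + (α : AddCircle (1:ℝ)) ∈ D ∨ v - (α : AddCircle (1:ℝ)) ∈ D) ∧
      2 * volume D < 2/3 + ε := by
  obtain ⟨e, he0, heε⟩ := ENNReal.lt_iff_exists_real_btwn.1 hε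
  have he : 0 < e := by simpa using heε.1
  have hz : (volume : Measure (AddCircle (1:ℝ))) {0} = 0 := by
    have := AddCircle.volume_closedBall (T := 1) (x := (0 : AddCircle (1:ℝ))) 0
    simpa using this
  obtain ⟨A, hsub, hA, hAe⟩ := Set.exists_isOpen_lt_of_lt (μ := (volume : Measure (AddCircle (1:ℝ))))
    {0} (ENNReal.ofReal (e/3)) (by rw [hz, ENNReal.ofReal_pos]; positivity)
  obtain ⟨D, hD, hdom, hm⟩ := exists_dominating α hirr A hA ⟨0, hsub rfl⟩
  refine ⟨D, hD, hdom, ?_⟩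
  have ha : volume.real A < e/3 := by
    rw [Measure.real]
    exact (ENNReal.lt_ofReal_iff_toReal_lt (measure_ne_top _ _)).1 hAe
  have h1 : 2 * volume D = ENNReal.ofReal (2 * volume.real D) := by
    rw [ENNReal.ofReal_mul (by norm_num)]; simp
  have h2 : (2/3 : ℝ≥0∞) = ENNReal.ofReal (2/3) := by
    rw [ENNReal.ofReal_div_of_pos (by norm_num)]; simp
  calc 2 * volume D = ENNReal.ofReal (2 * volume.real D) := h1
    _ ≤ ENNReal.ofReal (2/3 + e) := ENNReal.ofReal_le_ofReal (by linarith)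
    _ = 2/3 + ENNReal.ofReal e := by rw [h2, ENNReal.ofReal_add (by norm_num) he0]
    _ < 2/3 + ε := ENNReal.add_lt_add_left (ENNReal.div_ne_top (by simp) (by simp)) heε.2

/-- For irrational `α ∈ (0,1)` and every `ε > 0`, the irrational cycle graph
`G_α` admits a measurable Roman dominating function with no 1-labels and
measured value less than `2/3 + ε`; in particular the infimum of the measured
values of measurable Roman dominating functions for `G_α` is at most `2/3`. -/
theorem irrational_cycle_roman_upper_bound
    (α : ℝ) (hirr : Irrational α) (h0 : 0 < α) (h1 : α < 1) :
    (∀ ε : ℝ≥0∞, 0 < ε →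
      ∃ f : AddCircle (1:ℝ) → ℕ, (∀ v, f v ≤ 2) ∧
        (∀ v, f v = 0 →
          f (v + (α : AddCircle (1:ℝ))) = 2 ∨ f (v - (α : AddCircle (1:ℝ))) = 2) ∧
        MeasurableSet (f ⁻¹' {1}) ∧ MeasurableSet (f ⁻¹' {2}) ∧
        f ⁻¹' {1} = ∅ ∧
        2 * volume (f ⁻¹' {2}) < 2/3 + ε) ∧
    sInf {m : ℝ≥0∞ | ∃ f : AddCircle (1:ℝ) → ℕ, (∀ v, f v ≤ 2) ∧
        (∀ v, f v = 0 →
          f (v + (α : AddCircle (1:ℝ))) = 2 ∨ f (v - (α : AddCircle (1:ℝ))) = 2) ∧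
        MeasurableSet (f ⁻¹' {1}) ∧ MeasurableSet (f ⁻¹' {2}) ∧
        m = 2 * volume (f ⁻¹' {2}) + volume (f ⁻¹' {1})} ≤ 2/3 := by
  have key : (∀ ε : ℝ≥0∞, 0 < ε →
      ∃ f : AddCircle (1:ℝ) → ℕ, (∀ v, f v ≤ 2) ∧
        (∀ v, f v = 0 →
          f (v + (α : AddCircle (1:ℝ))) = 2 ∨ f (v - (α : AddCircle (1:ℝ))) = 2) ∧
        MeasurableSet (f ⁻¹' {1}) ∧ MeasurableSet (f ⁻¹' {2}) ∧
        f ⁻¹' {1} = ∅ ∧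
        2 * volume (f ⁻¹' {2}) < 2/3 + ε) := by
    classical
    intro ε hε
    obtain ⟨D, hD, hdom, hm⟩ := exists_dominating_small α hirr ε hε
    have e1 : (fun v => if v ∈ D then 2 else 0 : AddCircle (1:ℝ) → ℕ) ⁻¹' {1} = ∅ := by
      ext v; by_cases h : v ∈ D <;> simp [h]
    have e2 : (fun v => if v ∈ D then 2 else 0 : AddCircle (1:ℝ) → ℕ) ⁻¹' {2} = D := by
      ext v; by_cases h : v ∈ D <;> simp [h]
    refine ⟨fun v => if v ∈ D then 2 else 0, ?_, ?_, ?_, ?_, e1, ?_⟩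
    · intro v; dsimp only; split_ifs <;> simp
    · intro v hv
      simpa using hdom v (by simpa using hv)
    · rw [e1]; exact MeasurableSet.empty
    · rwa [e2]
    · rwa [e2]
  refine ⟨key, ?_⟩
  refine ENNReal.le_of_forall_pos_le_add fun ε hε _ => ?_
  obtain ⟨f, hf, hdom, hm1, hm2, he, hlt⟩ := key ε (by exact_mod_cast hε)
  refine sInf_le_of_le ⟨f, hf, hdom, hm1, hm2, rfl⟩ ?_
  rw [he, measure_empty, add_zero]
  exact hlt.le
end

section
/- Fix an irrational α with 0 < α < 1. Every measurable Roman dominating function f for the irrational cycle graph G_α has measured value at least 2/3, i.e. 2·μ(f⁻¹{2}) + μ(f⁻¹{1}) ≥ 2/3. -/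
open MeasureTheory
open scoped ENNReal

/-- For irrational `α ∈ (0,1)`, every measurable Roman dominating function for
the irrational cycle graph `G_α` has measured value at least `2/3`. -/
theorem irrational_cycle_roman_lower_bound
    (α : ℝ) (hirr : Irrational α) (h0 : 0 < α) (h1 : α < 1)
    (f : AddCircle (1:ℝ) → ℕ) (hf2 : ∀ v, f v ≤ 2)
    (hrdf : ∀ v, f v = 0 →
      f (v + (α : AddCircle (1:ℝ))) = 2 ∨ f (v - (α : AddCircle (1:ℝ))) = 2)
    (h1m : MeasurableSet (f ⁻¹' {1})) (h2m : MeasurableSet (f ⁻¹' {2})) :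
    2/3 ≤ 2 * volume (f ⁻¹' {2}) + volume (f ⁻¹' {1}) := by
  set A := f ⁻¹' {2} with hA
  set B := f ⁻¹' {1} with hB
  have hcov : (Set.univ : Set (AddCircle (1:ℝ))) ⊆
      B ∪ (A ∪ ((fun v => v + (α : AddCircle (1:ℝ))) ⁻¹' A ∪
        (fun v => v + (-(α : AddCircle (1:ℝ)))) ⁻¹' A)) := by
    intro v _
    have hle := hf2 v
    have hr := hrdf v
    simp only [hA, hB, Set.mem_union, Set.mem_preimage, Set.mem_singleton_iff,
      ← sub_eq_add_neg]
    by_cases hv : f v = 0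
    · exact Or.inr (Or.inr (hr hv))
    · have : f v = 1 ∨ f v = 2 := by omega
      tauto
  have huniv : volume (Set.univ : Set (AddCircle (1:ℝ))) = 1 := by
    rw [AddCircle.measure_univ, ENNReal.ofReal_one]
  have hle : (1 : ℝ≥0∞) ≤ volume B + (volume A + (volume A + volume A)) := by
    rw [← huniv]
    refine (measure_mono hcov).trans ((measure_union_le _ _).trans ?_)
    gcongr
    refine (measure_union_le _ _).trans ?_
    gcongr
    refine (measure_union_le _ _).trans ?_
    rw [measure_preimage_add_right, measure_preimage_add_right]
  apply ENNReal.div_le_of_le_mul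
  calc (2 : ℝ≥0∞) = 2 * 1 := by ring
    _ ≤ 2 * (volume B + (volume A + (volume A + volume A))) := by gcongr
    _ = 6 * volume A + 2 * volume B := by ring
    _ ≤ 6 * volume A + 3 * volume B := by gcongr; norm_num
    _ = (2 * volume A + volume B) * 3 := by ring
end

section
/- Fix an irrational α with 0 < α < 1. The infimum, over all measurable Roman dominating functions f for the irrational cycle graph G_α, of the measured value 2·μ(f⁻¹{2}) + μ(f⁻¹{1}) equals 2/3. -/
open MeasureTheory
open scoped ENNReal

lemma norm_coe_le_abs (t : ℝ) : ‖(t : AddCircle (1:ℝ))‖ ≤ |t| := by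
  rw [AddCircle.norm_eq]
  simp only [inv_one, one_mul, mul_one]
  simpa using round_le t 0

lemma circle_cover (y : AddCircle (1:ℝ)) :
    ‖y‖ ≤ 1/6 ∨ ‖y - ((1/3 : ℝ) : AddCircle (1:ℝ))‖ ≤ 1/6 ∨
      ‖y + ((1/3 : ℝ) : AddCircle (1:ℝ))‖ ≤ 1/6 := by
  obtain ⟨r, hr, rfl⟩ : ∃ r : ℝ, |r| ≤ 1/2 ∧ (r : AddCircle (1:ℝ)) = y := by
    induction y using QuotientAddGroup.induction_on with
    | H x =>
      refine ⟨x - round x, abs_sub_round x, ?_⟩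
      rw [AddCircle.coe_sub, sub_eq_self, AddCircle.coe_eq_zero_iff]
      exact ⟨round x, by simp⟩
  rw [abs_le] at hr
  rcases le_total r (-(1/6)) with h | h
  · right; right
    rw [← AddCircle.coe_add]
    refine (norm_coe_le_abs _).trans (abs_le.2 ⟨by linarith, by linarith⟩)
  rcases le_total r (1/6) with h' | h'
  · left
    exact (norm_coe_le_abs _).trans (abs_le.2 ⟨by linarith, by linarith⟩)
  · right; left
    rw [← AddCircle.coe_sub]
    refine (norm_coe_le_abs _).trans (abs_le.2 ⟨by linarith, by linarith⟩)

lemma exists_multiple (α : ℝ) (hirr : Irrational α) (δ : ℝ) (hδ : 0 < δ) (hδ' : δ ≤ 1/3) :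
    ∃ m : ℤ, m ≠ 0 ∧ ‖m • (α : AddCircle (1:ℝ)) - ((1/3 : ℝ) : AddCircle (1:ℝ))‖ < δ := by
  have hd : DenseRange (fun m : ℤ => m • (α : AddCircle (1:ℝ))) :=
    AddCircle.denseRange_zsmul_coe_iff.2 (by simpa using hirr)
  obtain ⟨m, hm⟩ := hd.exists_dist_lt ((1/3 : ℝ) : AddCircle (1:ℝ)) hδ
  rw [dist_comm, dist_eq_norm] at hm
  refine ⟨m, ?_, hm⟩
  rintro rfl
  rw [zero_smul, zero_sub, norm_neg,
    (AddCircle.norm_coe_eq_abs_iff 1 one_ne_zero).2 (by norm_num [abs_of_pos])] at hm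
  rw [abs_of_pos (by norm_num)] at hm
  linarith

lemma lower_bound (a : AddCircle (1:ℝ)) (f : AddCircle (1:ℝ) → ℕ) (hf : ∀ v, f v ≤ 2)
    (h : ∀ v, f v = 0 → f (v + a) = 2 ∨ f (v - a) = 2) :
    (2/3 : ℝ≥0∞) ≤ 2 * volume (f ⁻¹' {2}) + volume (f ⁻¹' {1}) := by
  have hc : (Set.univ : Set (AddCircle (1:ℝ))) ⊆
      (f ⁻¹' {1} ∪ f ⁻¹' {2}) ∪ ((fun v => v + a) ⁻¹' (f ⁻¹' {2}) ∪
        (fun v => v + -a) ⁻¹' (f ⁻¹' {2})) := by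
    intro v _
    have h2 := hf v
    have h3 := h v
    simp only [Set.mem_union, Set.mem_preimage, Set.mem_singleton_iff, ← sub_eq_add_neg]
    by_cases h0 : f v = 0
    · right; exact h3 h0
    · left; omega
  have hm : (1 : ℝ≥0∞) ≤ volume (f ⁻¹' {1}) + volume (f ⁻¹' {2}) +
      (volume (f ⁻¹' {2}) + volume (f ⁻¹' {2})) := by
    calc (1 : ℝ≥0∞) = volume (Set.univ : Set (AddCircle (1:ℝ))) := by
          rw [AddCircle.measure_univ]; simp
      _ ≤ _ := measure_mono hc
      _ ≤ _ := measure_union_le _ _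
      _ ≤ _ := add_le_add (measure_union_le _ _) (measure_union_le _ _)
      _ = _ := by rw [measure_preimage_add_right, measure_preimage_add_right]
  have t1 : volume (f ⁻¹' {1}) ≠ ∞ := measure_ne_top _ _
  have t2 : volume (f ⁻¹' {2}) ≠ ∞ := measure_ne_top _ _
  generalize volume (f ⁻¹' {1}) = x at *
  generalize volume (f ⁻¹' {2}) = y at *
  lift x to NNReal using t1
  lift y to NNReal using t2
  rw [ENNReal.div_le_iff (by norm_num) (by norm_num)]
  norm_cast at hm ⊢
  rw [← NNReal.coe_le_coe] at hm ⊢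
  push_cast at hm ⊢
  have := x.coe_nonneg
  linarith

/-- For irrational `α ∈ (0,1)`, the Roman domination measure of the irrational
cycle graph `G_α`, i.e. the infimum of the measured values of measurable Roman
dominating functions, equals `2/3`. -/
theorem irrational_cycle_roman_domination_measure
    (α : ℝ) (hirr : Irrational α) (h0 : 0 < α) (h1 : α < 1) :
    sInf {m : ℝ≥0∞ | ∃ f : AddCircle (1:ℝ) → ℕ, (∀ v, f v ≤ 2) ∧
        (∀ v, f v = 0 →
          f (v + (α : AddCircle (1:ℝ))) = 2 ∨ f (v - (α : AddCircle (1:ℝ))) = 2) ∧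
        MeasurableSet (f ⁻¹' {1}) ∧ MeasurableSet (f ⁻¹' {2}) ∧
        m = 2 * volume (f ⁻¹' {2}) + volume (f ⁻¹' {1})} = 2/3 := by
  classical
  apply le_antisymm
  · have key : ∀ δ : ℝ, 0 < δ → δ ≤ 1/3 → sInf {m : ℝ≥0∞ | ∃ f : AddCircle (1:ℝ) → ℕ, (∀ v, f v ≤ 2) ∧
        (∀ v, f v = 0 →
          f (v + (α : AddCircle (1:ℝ))) = 2 ∨ f (v - (α : AddCircle (1:ℝ))) = 2) ∧
        MeasurableSet (f ⁻¹' {1}) ∧ MeasurableSet (f ⁻¹' {2}) ∧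
        m = 2 * volume (f ⁻¹' {2}) + volume (f ⁻¹' {1})} ≤ ENNReal.ofReal (2/3 + 4 * δ) := by
      intro δ hδ hδ'
      obtain ⟨m, hm0, hm⟩ := exists_multiple α hirr δ hδ hδ'
      set A : Set (AddCircle (1:ℝ)) :=
        (fun v => m • v) ⁻¹' (Metric.closedBall 0 (1/6 + δ)) with hA
      have hmp : MeasurePreserving (fun v : AddCircle (1:ℝ) => m • v) volume volume :=
        Measure.measurePreserving_zsmul volume hm0
      have hAm : MeasurableSet A := hmp.measurable Metric.isClosed_closedBall.measurableSet
      have hAv : volume A ≤ ENNReal.ofReal (1/3 + 2 * δ) := by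
        rw [hA, hmp.measure_preimage Metric.isClosed_closedBall.measurableSet.nullMeasurableSet,
          AddCircle.volume_closedBall]
        apply ENNReal.ofReal_le_ofReal
        refine (min_le_right _ _).trans (by linarith)
      have e2 : (fun v => if v ∈ A then 2 else 0 : AddCircle (1:ℝ) → ℕ) ⁻¹' {2} = A := by
        ext v; by_cases hv : v ∈ A <;> simp [hv]
      have e1 : (fun v => if v ∈ A then 2 else 0 : AddCircle (1:ℝ) → ℕ) ⁻¹' {1} = ∅ := by
        ext v; by_cases hv : v ∈ A <;> simp [hv]
      refine sInf_le_of_le ⟨fun v => if v ∈ A then 2 else 0, ?_, ?_, ?_, ?_, rfl⟩ ?_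
      · intro v; dsimp only; split_ifs <;> simp
      · intro v hv
        have hvA : v ∉ A := by
          intro h; simp [h] at hv
        have hmem : ∀ w, w ∈ A ↔ ‖m • w‖ ≤ 1/6 + δ := by
          intro w; rw [hA, Set.mem_preimage, mem_closedBall_zero_iff]
        suffices v + (α : AddCircle (1:ℝ)) ∈ A ∨ v - (α : AddCircle (1:ℝ)) ∈ A by
          rcases this with h | h
          · left; simp [h]
          · right; simp [h]
        rw [hmem, not_le] at hvA
        rw [hmem, hmem, smul_add, smul_sub]
        rcases circle_cover (m • v) with h | h | h
        · linarith
        · right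
          calc _ = ‖(m • v - ((1/3 : ℝ) : AddCircle (1:ℝ))) -
                (m • (α : AddCircle (1:ℝ)) - ((1/3 : ℝ) : AddCircle (1:ℝ)))‖ := by
                congr 1; abel
            _ ≤ _ := norm_sub_le _ _
            _ ≤ _ := add_le_add h hm.le
        · left
          calc _ = ‖(m • v + ((1/3 : ℝ) : AddCircle (1:ℝ))) +
                (m • (α : AddCircle (1:ℝ)) - ((1/3 : ℝ) : AddCircle (1:ℝ)))‖ := by
                congr 1; abel
            _ ≤ _ := norm_add_le _ _
            _ ≤ _ := add_le_add h hm.le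
      · rw [e1]; exact MeasurableSet.empty
      · rw [e2]; exact hAm
      · rw [e1, e2, measure_empty, add_zero]
        calc 2 * volume A ≤ ENNReal.ofReal 2 * ENNReal.ofReal (1/3 + 2 * δ) := by
              rw [ENNReal.ofReal_ofNat]; gcongr
          _ = _ := by
              rw [← ENNReal.ofReal_mul (by norm_num)]; congr 1; ring
    have e23 : (2/3 : ℝ≥0∞) = ENNReal.ofReal (2/3) := by
      rw [ENNReal.ofReal_div_of_pos (by norm_num)]; simp
    rw [e23]
    have ht : Filter.Tendsto (fun δ : ℝ => ENNReal.ofReal (2/3 + 4 * δ))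
        (nhdsWithin 0 (Set.Ioi 0)) (nhds (ENNReal.ofReal (2/3))) := by
      have : Continuous (fun δ : ℝ => ENNReal.ofReal (2/3 + 4 * δ)) :=
        ENNReal.continuous_ofReal.comp (by fun_prop)
      have h := this.tendsto 0
      simp only [mul_zero, add_zero] at h
      exact h.mono_left nhdsWithin_le_nhds
    refine ge_of_tendsto ht ?_
    filter_upwards [Ioc_mem_nhdsGT (show (0:ℝ) < 1/3 by norm_num)] with δ hδ
    exact key δ hδ.1 hδ.2
  · apply le_sInf
    rintro m ⟨f, hf, hd, -, -, rfl⟩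
    exact lower_bound _ f hf hd
end

section
/- Fix an irrational α with 0 < α < 1. There is no measurable Roman dominating function f for the irrational cycle graph G_α whose measured value equals 2/3, i.e. no measurable Roman dominating function satisfies 2·μ(f⁻¹{2}) + μ(f⁻¹{1}) = 2/3. (Hence the infimum 2/3 of the measured values is not attained: G_α is Mithraic.) -/
open MeasureTheory
open scoped ENNReal

theorem mithraic_addOrderOf (α : ℝ) (hirr : Irrational α) :
    addOrderOf (((3 * α : ℝ)) : AddCircle (1:ℝ)) = 0 := by
  have key : addOrderOf (((3 * α : ℝ)) : AddCircle (1:ℝ)) = 0 := by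
    rw [addOrderOf_eq_zero_iff']
    intro n hn h
    rw [← AddCircle.coe_nsmul, AddCircle.coe_eq_zero_iff] at h
    obtain ⟨m, hm⟩ := h
    have hn0 : (n : ℝ) ≠ 0 := by positivity
    apply hirr
    refine ⟨(m : ℚ) / (3 * n), ?_⟩
    push_cast
    simp only [nsmul_eq_mul, zsmul_eq_mul, mul_one] at hm
    rw [hm]
    field_simp
  exact key

/-- The irrational cycle graph `G_α` is Mithraic: no measurable Roman
dominating function for `G_α` has measured value exactly `2/3`. -/
theorem irrational_cycle_is_mithraic
    (α : ℝ) (hirr : Irrational α) (h0 : 0 < α) (h1 : α < 1) :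
    ¬ ∃ f : AddCircle (1:ℝ) → ℕ, (∀ v, f v ≤ 2) ∧
      (∀ v, f v = 0 →
        f (v + (α : AddCircle (1:ℝ))) = 2 ∨ f (v - (α : AddCircle (1:ℝ))) = 2) ∧
      MeasurableSet (f ⁻¹' {1}) ∧ MeasurableSet (f ⁻¹' {2}) ∧
      2 * volume (f ⁻¹' {2}) + volume (f ⁻¹' {1}) = 2/3 := by
  rintro ⟨f, hf2, hdom, hB, hA, hval⟩
  have herg := AddCircle.ergodic_add_right.2 (mithraic_addOrderOf α hirr)
  have hth : ((3 * α : ℝ) : AddCircle (1:ℝ)) = (α : AddCircle (1:ℝ)) + α + α := by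
    rw [← AddCircle.coe_add, ← AddCircle.coe_add]; congr 1; ring
  rw [hth] at herg
  generalize (α : AddCircle (1:ℝ)) = a at *
  set A := f ⁻¹' {2} with hAdef
  set B := f ⁻¹' {1} with hBdef
  have hpos : MeasurePreserving (fun v : AddCircle (1:ℝ) => v + a) volume volume :=
    measurePreserving_add_right volume a
  have hneg : MeasurePreserving (fun v : AddCircle (1:ℝ) => v - a) volume volume :=
    measurePreserving_sub_right volume a
  have hcov : ∀ v, v ∈ B ∨ v ∈ A ∨ v + a ∈ A ∨ v - a ∈ A := by
    intro v
    have h2 := hf2 v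
    have h3 := hdom v
    simp only [hAdef, hBdef, Set.mem_preimage, Set.mem_singleton_iff]
    by_cases h : f v = 0
    · have := h3 h; tauto
    · omega
  have hu : (volume : Measure (AddCircle (1:ℝ))).real Set.univ = 1 := by
    simp [measureReal_def, AddCircle.measure_univ]
  have hvr : 2 * volume.real A + volume.real B = 2/3 := by
    have := congrArg ENNReal.toReal hval
    rw [ENNReal.toReal_add (by finiteness) (by finiteness)] at this
    simpa [measureReal_def] using this
  set A1 := (fun v : AddCircle (1:ℝ) => v + a) ⁻¹' A with hA1
  set A2 := (fun v : AddCircle (1:ℝ) => v - a) ⁻¹' A with hA2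
  have m1 : volume.real A1 = volume.real A := by
    simp only [measureReal_def]; rw [hpos.measure_preimage hA.nullMeasurableSet]
  have m2 : volume.real A2 = volume.real A := by
    simp only [measureReal_def]; rw [hneg.measure_preimage hA.nullMeasurableSet]
  have hA1m : MeasurableSet A1 := hpos.measurable hA
  have hA2m : MeasurableSet A2 := hneg.measurable hA
  have tri : ∀ X Y Z : Set (AddCircle (1:ℝ)), MeasurableSet Y →
      B ∪ (X ∪ Y) ∪ Z = Set.univ → 
      1 + volume.real (X ∩ Y) ≤ volume.real B + (volume.real X + volume.real Y) + volume.real Z := by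
    intro X Y Z hY h
    have e1 := measureReal_union_add_inter (μ := (volume : Measure (AddCircle (1:ℝ)))) (s := X) hY
    have e2 := measureReal_union_le (μ := (volume : Measure (AddCircle (1:ℝ)))) (B ∪ (X ∪ Y)) Z
    have e3 := measureReal_union_le (μ := (volume : Measure (AddCircle (1:ℝ)))) B (X ∪ Y)
    rw [h, hu] at e2
    linarith
  have t1 := tri A A1 A2 hA1m (by
    ext v; have := hcov v
    simp only [Set.mem_union, hA1, hA2, Set.mem_preimage, Set.mem_univ]; tauto)
  have t2 := tri A1 A2 A hA2m (by
    ext v; have := hcov v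
    simp only [Set.mem_union, hA1, hA2, Set.mem_preimage, Set.mem_univ]; tauto)
  rw [m1, m2] at t1 t2
  have p1 := measureReal_nonneg (μ := (volume : Measure (AddCircle (1:ℝ)))) (s := A ∩ A1)
  have p2 := measureReal_nonneg (μ := (volume : Measure (AddCircle (1:ℝ)))) (s := A1 ∩ A2)
  have p3 := measureReal_nonneg (μ := (volume : Measure (AddCircle (1:ℝ)))) (s := B)
  have z1 : volume.real (A ∩ A1) = 0 := by linarith
  have z2 : volume.real (A1 ∩ A2) = 0 := by linarith
  have z3 : volume.real B = 0 := by linarith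
  have zA : volume.real A = 1/3 := by linarith
  rw [measureReal_eq_zero_iff] at z1 z2 z3
  have q1 := measure_eq_zero_iff_ae_notMem.1 z1
  have q2 := hpos.quasiMeasurePreserving.ae (measure_eq_zero_iff_ae_notMem.1 z2)
  have q3 := hpos.quasiMeasurePreserving.ae
    (hpos.quasiMeasurePreserving.ae (measure_eq_zero_iff_ae_notMem.1 z3))
  have hle : A ≤ᵐ[volume] (fun v => v + (a + a + a)) ⁻¹' A := by
    filter_upwards [q1, q2, q3] with v w1 w2 w3 hv
    have hc := hcov (v + a + a)
    simp only [hA1, hA2, Set.mem_inter_iff, Set.mem_preimage, add_sub_cancel_right] at w1 w2 hc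
    have hv : v ∈ A := hv
    show v + (a + a + a) ∈ A
    rw [← add_assoc, ← add_assoc]
    tauto
  rcases herg.ae_empty_or_univ_of_ae_le_preimage hA.nullMeasurableSet hle with h | h
  · have := measureReal_congr h
    rw [zA] at this
    norm_num at this
  · have := measureReal_congr h
    rw [zA, hu] at this
    norm_num at this
end

section
/- Fix an irrational α with 0 < α < 1. For every measurable Roman dominating function f for the irrational cycle graph G_α we have μ(f⁻¹{0}) ≤ 2·μ(f⁻¹{2}). -/
open MeasureTheory
open scoped ENNReal

/-- For every measurable Roman dominating function `f` on the irrational cycle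
graph `G_α`, the measure of the 0-labelled vertices is at most twice the
measure of the 2-labelled vertices. -/
theorem zeros_measure_le_twice_twos
    (α : ℝ) (hirr : Irrational α) (h0 : 0 < α) (h1 : α < 1)
    (f : AddCircle (1:ℝ) → ℕ) (hf2 : ∀ v, f v ≤ 2)
    (hrdf : ∀ v, f v = 0 →
      f (v + (α : AddCircle (1:ℝ))) = 2 ∨ f (v - (α : AddCircle (1:ℝ))) = 2)
    (h1m : MeasurableSet (f ⁻¹' {1})) (h2m : MeasurableSet (f ⁻¹' {2})) :
    volume (f ⁻¹' {0}) ≤ 2 * volume (f ⁻¹' {2}) := by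
  have hsub : f ⁻¹' {0} ⊆
      ((fun v => v + (α : AddCircle (1:ℝ))) ⁻¹' (f ⁻¹' {2})) ∪
      ((fun v => v + (-(α : AddCircle (1:ℝ)))) ⁻¹' (f ⁻¹' {2})) := by
    intro v hv
    rcases hrdf v hv with h | h
    · exact Or.inl h
    · right
      simpa [sub_eq_add_neg] using h
  refine (measure_mono hsub).trans ((measure_union_le _ _).trans ?_)
  rw [measure_preimage_add_right, measure_preimage_add_right, two_mul]
end
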